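/- arXiv:2009.10655 — 2 statements merged into one kernel-verified Lean document; each statement's English description precedes it below -/
import Mathlib

section
/- For every integer n ≥ 2 and every 0 ≤ k ≤ n-1, the following recurrences hold: P_{n,k} = k·Q_{n-1,k} + (n−k)·Q_{n-1,k-1} + P_{n-1,k}, and Q_{n,k} = k·P_{n-1,k} + (n−k)·P_{n-1,k-1} + Q_{n-1,k} (with the convention that P_{n-1,j} = Q_{n-1,j} = 0 when j < 0 or j > n-2). -/
/-- Number of excedances of a permutation of `{1,…,n}` (encoded on `Fin n`):
`exc σ = |{i : σ(i) > i}|`. -/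
def excA {n : ℕ} (σ : Equiv.Perm (Fin n)) : ℕ :=
  (Finset.univ.filter (fun i : Fin n => i < σ i)).card

/-- `P n k`: number of even permutations of `[n]` with exactly `k` excedances. -/
def P (n k : ℕ) : ℕ :=
  (Finset.univ.filter (fun σ : Equiv.Perm (Fin n) =>
    Equiv.Perm.sign σ = 1 ∧ excA σ = k)).card

/-- `Q n k`: number of odd permutations of `[n]` with exactly `k` excedances. -/
def Q (n k : ℕ) : ℕ :=
  (Finset.univ.filter (fun σ : Equiv.Perm (Fin n) =>
    Equiv.Perm.sign σ = -1 ∧ excA σ = k)).card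

/-- `P` with an integer index: `Pz n k = P n k` for `k ≥ 0`, and `0` for `k < 0`. -/
def Pz (n : ℕ) (k : ℤ) : ℕ := if 0 ≤ k then P n k.toNat else 0

/-- `Q` with an integer index: `Qz n k = Q n k` for `k ≥ 0`, and `0` for `k < 0`. -/
def Qz (n : ℕ) (k : ℤ) : ℕ := if 0 ≤ k then Q n k.toNat else 0

/-- The number of permutations of `[n]` with sign `s` and exactly `k` excedances. -/
def signedExcCount (s : ℤˣ) (n k : ℕ) : ℕ :=
  (Finset.univ.filter (fun σ : Equiv.Perm (Fin n) =>
    Equiv.Perm.sign σ = s ∧ excA σ = k)).card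

lemma excA_decomposeFin_symm_zero {m : ℕ} (e : Equiv.Perm (Fin m)) :
    excA (Equiv.Perm.decomposeFin.symm (0, e)) = excA e := by
  simp only [excA, Finset.card_filter, Fin.sum_univ_succ,
    Equiv.Perm.decomposeFin_symm_apply_zero, Equiv.Perm.decomposeFin_symm_apply_succ,
    Equiv.swap_self, Equiv.refl_apply, Fin.succ_lt_succ_iff, lt_irrefl, if_false, zero_add]

/-- Inserting a new minimum into the cycle of `e`, right after `j`, creates an excedance at the
minimum and destroys the one at `j`, if any. -/
lemma excA_decomposeFin_symm_succ {m : ℕ} (e : Equiv.Perm (Fin m)) (j : Fin m) :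
    excA (Equiv.Perm.decomposeFin.symm ((e j).succ, e)) + (if j < e j then 1 else 0) =
      excA e + 1 := by
  have pointwise (i : Fin m) : (if i < e i then 1 else 0) =
      (if i.succ < Equiv.swap 0 (e j).succ (e i).succ then 1 else 0) +
        (if i = j then (if j < e j then 1 else 0) else 0) := by
    by_cases h : i = j
    · subst h
      simp
    · have hne : (e i).succ ≠ (e j).succ := fun h' => h (e.injective (Fin.succ_injective _ h'))
      rw [Equiv.swap_apply_of_ne_of_ne (Fin.succ_ne_zero _) hne]
      simp [h]
  simp only [excA, Finset.card_filter, Fin.sum_univ_succ,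
    Equiv.Perm.decomposeFin_symm_apply_zero, Equiv.Perm.decomposeFin_symm_apply_succ,
    Fin.succ_pos, if_true]
  rw [Finset.sum_congr rfl fun i _ => pointwise i, Finset.sum_add_distrib]
  simp
  ring

lemma card_excA_decomposeFin_symm_succ_eq {m : ℕ} (e : Equiv.Perm (Fin m)) (k : ℕ) :
    (∑ p : Fin m, if excA (Equiv.Perm.decomposeFin.symm (p.succ, e)) = k then (1 : ℤ) else 0) =
      (k : ℤ) * (if excA e = k then 1 else 0) +
        ((m : ℤ) + 1 - k) * (if excA e + 1 = k then 1 else 0) := by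
  have hexc : (∑ j : Fin m, if j < e j then (1 : ℤ) else 0) = excA e := by
    simp [excA]
  have pointwise (j : Fin m) :
      (if excA (Equiv.Perm.decomposeFin.symm ((e j).succ, e)) = k then (1 : ℤ) else 0) =
        (if j < e j then 1 else 0) * (if excA e = k then 1 else 0) +
          (1 - (if j < e j then 1 else 0)) * (if excA e + 1 = k then 1 else 0) := by
    have h := excA_decomposeFin_symm_succ e j
    by_cases hj : j < e j
    · simp only [hj, if_true, add_left_inj] at h
      simp [hj, h]
    · simp only [hj, if_false, add_zero] at h
      simp [hj, h]
  rw [← Equiv.sum_comp e, Finset.sum_congr rfl fun j _ => pointwise j, Finset.sum_add_distrib,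
    ← Finset.sum_mul, ← Finset.sum_mul, Finset.sum_sub_distrib, hexc]
  have hk : (excA e : ℤ) * (if excA e = k then 1 else 0) = k * (if excA e = k then 1 else 0) := by
    split_ifs with h <;> simp [h]
  rw [hk]
  congr 1
  split_ifs with h
  · subst h
    simp
  · simp

lemma signedExcCount_eq_sum (s : ℤˣ) (n k : ℕ) :
    (signedExcCount s n k : ℤ) =
      ∑ σ : Equiv.Perm (Fin n),
        (if Equiv.Perm.sign σ = s then 1 else 0) * (if excA σ = k then 1 else 0) := by
  simp only [signedExcCount, Finset.card_filter, ite_and, Nat.cast_sum, Nat.cast_ite, Nat.cast_one,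
    Nat.cast_zero, ite_mul, one_mul, zero_mul]

lemma signedExcCount_succ (s : ℤˣ) (m k : ℕ) :
    (signedExcCount s (m + 1) k : ℤ) =
      k * signedExcCount (-s) m k +
        ((m : ℤ) + 1 - k) * (∑ σ : Equiv.Perm (Fin m),
          (if Equiv.Perm.sign σ = -s then 1 else 0) * (if excA σ + 1 = k then 1 else 0)) +
        signedExcCount s m k := by
  simp only [signedExcCount_eq_sum]
  rw [← Equiv.sum_comp Equiv.Perm.decomposeFin.symm, Fintype.sum_prod_type_right,
    Finset.mul_sum, Finset.mul_sum, ← Finset.sum_add_distrib, ← Finset.sum_add_distrib]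
  refine Finset.sum_congr rfl fun e _ => ?_
  simp only [Fin.sum_univ_succ, excA_decomposeFin_symm_zero, Equiv.Perm.decomposeFin.symm_sign,
    Fin.succ_ne_zero, if_true, if_false, one_mul, neg_mul, neg_eq_iff_eq_neg]
  rw [← Finset.mul_sum, card_excA_decomposeFin_symm_succ_eq]
  ring

/-- The excedance recurrence at `k`, with the count at `k - 1` read as `0` when `k = 0`. -/
lemma signedExcCount_recurrence (s : ℤˣ) (m k : ℕ) :
    (signedExcCount s (m + 1) k : ℤ) =
      k * signedExcCount (-s) m k +
        ((m : ℤ) + 1 - k) *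
          ((if (0 : ℤ) ≤ (k : ℤ) - 1 then signedExcCount (-s) m ((k : ℤ) - 1).toNat else 0 : ℕ) : ℤ) +
        signedExcCount s m k := by
  rw [signedExcCount_succ]
  cases k with
  | zero => simp
  | succ k => simp [signedExcCount_eq_sum]

/-- **Lemma (Mantaci).** For every `n ≥ 2` and `0 ≤ k ≤ n-1`:
`P_{n,k} = k·Q_{n-1,k} + (n−k)·Q_{n-1,k-1} + P_{n-1,k}` and
`Q_{n,k} = k·P_{n-1,k} + (n−k)·P_{n-1,k-1} + Q_{n-1,k}`
(with the convention that terms with index `< 0` vanish). -/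
theorem typeA_excedance_recurrence (n : ℕ) (hn : 2 ≤ n) (k : ℤ) (hk0 : 0 ≤ k)
    (hk : k ≤ (n : ℤ) - 1) :
    (Pz n k : ℤ) = k * (Qz (n - 1) k : ℤ) + ((n : ℤ) - k) * (Qz (n - 1) (k - 1) : ℤ) +
        (Pz (n - 1) k : ℤ) ∧
      (Qz n k : ℤ) = k * (Pz (n - 1) k : ℤ) + ((n : ℤ) - k) * (Pz (n - 1) (k - 1) : ℤ) +
        (Qz (n - 1) k : ℤ) := by
  obtain ⟨m, rfl⟩ : ∃ m, n = m + 1 := ⟨n - 1, by omega⟩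
  lift k to ℕ using hk0
  have hP := signedExcCount_recurrence 1 m k
  have hQ := signedExcCount_recurrence (-1) m k
  rw [neg_neg] at hQ
  simp only [Pz, Qz, Nat.cast_nonneg, if_true, Int.toNat_natCast, Nat.add_sub_cancel,
    Nat.cast_add, Nat.cast_one]
  exact ⟨hP, hQ⟩
end

section
/- For every positive integer n and every 0 ≤ k ≤ n, P^B_{n,k} = B^+_{n,k} and Q^B_{n,k} = B^-_{n,k}; that is, on each of B_n^+ and B_n^-, the number of elements with k Type B excedances equals the number of elements with k Type B descents. -/
/-- An element of the hyperoctahedral group `B_n`, encoded as a pair `(σ, ε)` of a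
permutation of `Fin n` and a sign vector: the corresponding signed permutation sends
`i+1` (for `i : Fin n`) to `±(σ(i)+1)`, and `-(i+1)` to `∓(σ(i)+1)`. -/
abbrev SignedPerm (n : ℕ) := Equiv.Perm (Fin n) × (Fin n → Bool)

/-- The value `π(i+1) ∈ {-n,…,-1,1,…,n}` of the signed permutation at `i+1`. -/
def valB {n : ℕ} (p : SignedPerm n) (i : Fin n) : ℤ :=
  if p.2 i then -((p.1 i : ℤ) + 1) else (p.1 i : ℤ) + 1

/-- The signed permutation as a function on `ℤ` (value `0` outside `{-n,…,-1,1,…,n}`;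
in particular `π(0) = 0`). -/
def appB {n : ℕ} (p : SignedPerm n) (x : ℤ) : ℤ :=
  if h : 1 ≤ x ∧ x ≤ (n : ℤ) then valB p ⟨x.toNat - 1, by omega⟩
  else if h' : 1 ≤ -x ∧ -x ≤ (n : ℤ) then -(valB p ⟨(-x).toNat - 1, by omega⟩)
  else 0

/-- Type B inversions:
`inv_B(π) = |{i<j : π(i)>π(j)}| + |{i<j : -π(i)>π(j)}| + |{i : π(i)<0}|`. -/
def invB {n : ℕ} (p : SignedPerm n) : ℕ :=
  (Finset.univ.filter (fun ij : Fin n × Fin n =>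
      ij.1 < ij.2 ∧ valB p ij.1 > valB p ij.2)).card +
  (Finset.univ.filter (fun ij : Fin n × Fin n =>
      ij.1 < ij.2 ∧ -valB p ij.1 > valB p ij.2)).card +
  (Finset.univ.filter (fun i : Fin n => valB p i < 0)).card

/-- Type B excedances (Brenti):
`exc_B(π) = |{i ∈ [n] : π(|π(i)|) > π(i)}| + |{i ∈ [n] : π(i) = -i}|`. -/
def excB {n : ℕ} (p : SignedPerm n) : ℕ :=
  (Finset.univ.filter (fun i : Fin n => appB p |valB p i| > valB p i)).card +
  (Finset.univ.filter (fun i : Fin n => valB p i = -((i : ℤ) + 1))).card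

/-- Type B descents (with the convention `π(0) = 0`):
`des_B(π) = |{i ∈ {0,…,n-1} : π(i) > π(i+1)}|`. -/
def desB {n : ℕ} (p : SignedPerm n) : ℕ :=
  (Finset.univ.filter (fun i : Fin n => appB p (i : ℤ) > appB p ((i : ℤ) + 1))).card

/-- `PB n k`: number of elements of `B_n^+` (even `inv_B`) with `k` type B excedances. -/
def PB (n k : ℕ) : ℕ :=
  (Finset.univ.filter (fun p : SignedPerm n => Even (invB p) ∧ excB p = k)).card

/-- `QB n k`: number of elements of `B_n^-` (odd `inv_B`) with `k` type B excedances. -/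
def QB (n k : ℕ) : ℕ :=
  (Finset.univ.filter (fun p : SignedPerm n => ¬ Even (invB p) ∧ excB p = k)).card

/-- `Bp n k`: number of elements of `B_n^+` with `k` type B descents. -/
def Bp (n k : ℕ) : ℕ :=
  (Finset.univ.filter (fun p : SignedPerm n => Even (invB p) ∧ desB p = k)).card

/-- `Bm n k`: number of elements of `B_n^-` with `k` type B descents. -/
def Bm (n k : ℕ) : ℕ :=
  (Finset.univ.filter (fun p : SignedPerm n => ¬ Even (invB p) ∧ desB p = k)).card

open Equiv Finset

section Sign

variable {n : ℕ}

/-- The determinant of the signed permutation matrix. -/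
def detB (p : SignedPerm n) : ℤˣ :=
  Perm.sign p.1 * ∏ i, if p.2 i then -1 else 1

lemma valB_neg_iff (p : SignedPerm n) (i : Fin n) : valB p i < 0 ↔ p.2 i = true := by
  unfold valB
  split_ifs with h <;> simp [h] <;> omega

lemma neg_one_pow_card_filter {ι : Type*} [Fintype ι] (P : ι → Prop) [DecidablePred P] :
    (-1 : ℤˣ) ^ (univ.filter P).card = ∏ i, if P i then -1 else 1 := by
  rw [prod_ite]
  simp

lemma neg_one_pow_invB (p : SignedPerm n) : (-1 : ℤˣ) ^ invB p = detB p := by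
  unfold invB detB
  rw [pow_add, pow_add]
  congr 1
  · rw [neg_one_pow_card_filter, neg_one_pow_card_filter, ← prod_mul_distrib,
      Fintype.prod_prod_type, Perm.sign_eq_prod_prod_Ioi]
    refine prod_congr rfl fun i _ => ?_
    rw [← filter_lt_eq_Ioi, prod_filter]
    refine prod_congr rfl fun j _ => ?_
    by_cases hij : i < j
    · have hne : (p.1 i : ℕ) ≠ p.1 j := fun h => hij.ne (p.1.injective (Fin.ext h))
      simp only [hij, true_and, if_true, valB, Fin.lt_def]
      cases p.2 i <;> cases p.2 j <;> rcases lt_or_gt_of_ne hne with h | h <;> split_ifs <;>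
        first | rfl | omega
    · simp [hij]
  · rw [neg_one_pow_card_filter]
    simp only [valB_neg_iff]

lemma even_invB_iff (p : SignedPerm n) : Even (invB p) ↔ detB p = 1 := by
  rw [← neg_one_pow_invB]
  rcases Nat.even_or_odd (invB p) with h | h
  · simp [h, h.neg_one_pow]
  · simp [Nat.not_even_iff_odd.2 h, h.neg_one_pow]

end Sign

section Insertion

variable {n : ℕ}

/-- Extend a signed permutation by a fixed absolute value `n + 1`, with sign given by `d`. -/
def extendLast (p : SignedPerm n) (d : Bool) : SignedPerm (n + 1) :=
  (finSuccEquivLast.symm.permCongr (optionCongr p.1), Fin.snoc (α := fun _ => Bool) p.2 d)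

/-- Precompose a signed permutation with an unsigned one. -/
def precomp (p : SignedPerm n) (c : Perm (Fin n)) : SignedPerm n := (p.1 * c, p.2 ∘ c)

@[simp] lemma extendLast_fst_castSucc (p : SignedPerm n) (d : Bool) (i : Fin n) :
    (extendLast p d).1 i.castSucc = (p.1 i).castSucc := by
  simp [extendLast, permCongr_apply]

@[simp] lemma extendLast_fst_last (p : SignedPerm n) (d : Bool) :
    (extendLast p d).1 (Fin.last n) = Fin.last n := by
  simp [extendLast, permCongr_apply]

@[simp] lemma extendLast_snd_castSucc (p : SignedPerm n) (d : Bool) (i : Fin n) :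
    (extendLast p d).2 i.castSucc = p.2 i := by
  simp [extendLast]

@[simp] lemma extendLast_snd_last (p : SignedPerm n) (d : Bool) :
    (extendLast p d).2 (Fin.last n) = d := by
  simp [extendLast]

/-- The signed value `±(n + 1)` inserted into a signed permutation of size `n`. -/
def topVal (n : ℕ) (d : Bool) : ℤ := if d then -((n : ℤ) + 1) else (n : ℤ) + 1

@[simp] lemma valB_extendLast_castSucc (p : SignedPerm n) (d : Bool) (i : Fin n) :
    valB (extendLast p d) i.castSucc = valB p i := by
  simp [valB]

@[simp] lemma valB_extendLast_last (p : SignedPerm n) (d : Bool) :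
    valB (extendLast p d) (Fin.last n) = topVal n d := by
  simp [valB, topVal]

@[simp] lemma valB_precomp (p : SignedPerm n) (c : Perm (Fin n)) (i : Fin n) :
    valB (precomp p c) i = valB p (c i) := by
  simp [valB, precomp]

lemma detB_extendLast (p : SignedPerm n) (d : Bool) :
    detB (extendLast p d) = detB p * if d then -1 else 1 := by
  unfold detB
  rw [Fin.prod_univ_castSucc]
  simp only [extendLast_snd_castSucc, extendLast_snd_last, mul_assoc]
  congr 1
  simp [extendLast]

lemma detB_precomp (p : SignedPerm n) (c : Perm (Fin n)) :
    detB (precomp p c) = Perm.sign c * detB p := by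
  unfold detB
  have : ∏ i, (if (precomp p c).2 i then (-1 : ℤˣ) else 1) = ∏ i, if p.2 i then -1 else 1 :=
    Equiv.prod_comp c fun i => if p.2 i then (-1 : ℤˣ) else 1
  rw [this]
  simp [precomp, mul_assoc, mul_left_comm]

lemma insertion_bijective (c : Fin (n + 1) → Perm (Fin (n + 1))) (hc : ∀ j, c j j = Fin.last n) :
    Function.Bijective fun x : SignedPerm n × Fin (n + 1) × Bool =>
      precomp (extendLast x.1 x.2.2) (c x.2.1) := by
  rw [Fintype.bijective_iff_injective_and_card]
  constructor
  · rintro ⟨p, j, d⟩ ⟨p', j', d'⟩ h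
    simp only [precomp, Prod.mk.injEq] at h
    obtain ⟨h1, h2⟩ := h
    have hj : j = j' := by
      have e1 : ((extendLast p d).1 * c j) j = Fin.last n := by simp [hc]
      have e2 : ((extendLast p' d').1 * c j') j' = Fin.last n := by simp [hc]
      rw [h1] at e1
      exact Equiv.injective _ (e1.trans e2.symm)
    subst hj
    have h1' := mul_right_cancel h1
    have h2' : (extendLast p d).2 = (extendLast p' d').2 := (c j).surjective.injective_comp_right h2
    have hd : d = d' := by simpa using congrFun h2' (Fin.last n)
    have hp : p = p' := by
      refine Prod.ext (Equiv.ext fun i => ?_) (funext fun i => ?_)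
      · simpa using DFunLike.congr_fun h1' i.castSucc
      · simpa using congrFun h2' i.castSucc
    rw [hd, hp]
  · simp [Fintype.card_perm, Nat.factorial_succ, pow_succ]
    ring

/-- A statistic that changes under suitable insertions of `±(n + 1)` in the Eulerian way has joint
distribution with the determinant determined by the previous size. -/
lemma sum_insertion {M : Type*} [AddCommMonoid M] (st : SignedPerm n → ℕ)
    (st' : SignedPerm (n + 1) → ℕ) (D : SignedPerm n → Fin n → Prop) [∀ p, DecidablePred (D p)]
    (hD : ∀ p, st p = (univ.filter (D p)).card)
    (c : Fin (n + 1) → Perm (Fin (n + 1))) (hc : ∀ j, c j j = Fin.last n)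
    (hlast : c (Fin.last n) = 1)
    (h_ext : ∀ p d, st' (extendLast p d) = st p + if d then 1 else 0)
    (h_ins : ∀ p d i, st' (precomp (extendLast p d) (c (Fin.castSucc i))) =
      st p + if D p i then 0 else 1)
    (g : ℕ → ℤˣ → M) :
    ∑ p, g (st' p) (detB p) = ∑ p : SignedPerm n,
      (st p • (g (st p) 1 + g (st p) (-1)) +
        (n - st p) • (g (st p + 1) 1 + g (st p + 1) (-1)) +
        (g (st p) (detB p) + g (st p + 1) (-detB p))) := by
  rw [← (insertion_bijective c hc).sum_comp, Fintype.sum_prod_type]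
  refine sum_congr rfl fun p _ => ?_
  have hcard : (univ.filter fun i => ¬ D p i).card = n - st p := by
    have := card_filter_add_card_filter_not (s := univ) (D p)
    rw [← hD, card_univ, Fintype.card_fin] at this
    omega
  have h_pair : ∀ i : Fin n,
      ∑ d : Bool, g (st' (precomp (extendLast p d) (c i.castSucc)))
        (detB (precomp (extendLast p d) (c i.castSucc))) =
      if D p i then g (st p) 1 + g (st p) (-1) else g (st p + 1) 1 + g (st p + 1) (-1) := by
    intro i
    simp only [h_ins, detB_precomp, detB_extendLast, Fintype.sum_bool]
    rcases Int.units_eq_one_or (Perm.sign (c i.castSucc)) with h | h <;>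
      rcases Int.units_eq_one_or (detB p) with h' | h' <;>
      by_cases hDi : D p i <;> simp [h, h', hDi, add_comm]
  have h_one : ∀ q : SignedPerm (n + 1), precomp q 1 = q := fun q => rfl
  rw [Fintype.sum_prod_type, Fin.sum_univ_castSucc]
  simp only [h_pair, hlast, h_one, h_ext, detB_extendLast, Fintype.sum_bool]
  rw [sum_ite, sum_const, sum_const, hcard, ← hD]
  simp [add_comm]

end Insertion

section Bounds

variable {n : ℕ}

lemma valB_abs (p : SignedPerm n) (i : Fin n) : |valB p i| = (p.1 i : ℤ) + 1 := by
  unfold valB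
  split_ifs
  · rw [abs_neg, abs_of_pos (by positivity)]
  · rw [abs_of_pos (by positivity)]

lemma valB_bounds (p : SignedPerm n) (i : Fin n) : -(n : ℤ) ≤ valB p i ∧ valB p i ≤ n := by
  rw [← abs_le, valB_abs]
  have := (p.1 i).2
  omega

lemma appB_succ (p : SignedPerm n) (i : Fin n) : appB p ((i : ℤ) + 1) = valB p i := by
  have hi := i.2
  unfold appB
  rw [dif_pos (by omega)]
  congr 1

lemma appB_zero (p : SignedPerm n) : appB p 0 = 0 := by
  simp [appB]

lemma appB_bounds (p : SignedPerm n) (x : ℤ) : -(n : ℤ) ≤ appB p x ∧ appB p x ≤ n := by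
  unfold appB
  split_ifs with h h'
  · exact valB_bounds p _
  · have := valB_bounds p ⟨(-x).toNat - 1, by omega⟩
    omega
  · omega

end Bounds

section Descents

variable {n : ℕ}

/-- The descents of a sequence after inserting a new term at position `i + 1`. -/
lemma sum_insert_descents (f f' : ℕ → ℤ) {i n : ℕ} (hi : i < n)
    (h_le : ∀ k ≤ i, f' k = f k) (h_gt : ∀ k, i < k → k ≤ n → f' (k + 1) = f k)
    (h_one : (if f i > f' (i + 1) then 1 else 0) + (if f' (i + 1) > f (i + 1) then 1 else 0) = 1) :
    (∑ k ∈ range (n + 1), if f' k > f' (k + 1) then 1 else 0) + (if f i > f (i + 1) then 1 else 0) =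
      (∑ k ∈ range n, if f k > f (k + 1) then 1 else 0) + 1 := by
  obtain ⟨m, rfl⟩ : ∃ m, n = i + 1 + m := ⟨n - (i + 1), by omega⟩
  rw [show i + 1 + m + 1 = i + 2 + m by omega, sum_range_add _ (i + 2), sum_range_succ _ (i + 1),
    sum_range_succ _ i, sum_range_add _ (i + 1), sum_range_succ _ i]
  have e1 : ∑ k ∈ range i, (if f' k > f' (k + 1) then 1 else 0) =
      ∑ k ∈ range i, if f k > f (k + 1) then 1 else 0 :=
    sum_congr rfl fun k hk => by
      have := mem_range.1 hk
      rw [h_le k (by omega), h_le (k + 1) (by omega)]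
  have e2 : ∑ k ∈ range m, (if f' (i + 2 + k) > f' (i + 2 + k + 1) then 1 else 0) =
      ∑ k ∈ range m, if f (i + 1 + k) > f (i + 1 + k + 1) then 1 else 0 :=
    sum_congr rfl fun k hk => by
      have := mem_range.1 hk
      rw [show i + 2 + k = i + 1 + k + 1 by omega, h_gt (i + 1 + k) (by omega) (by omega),
        h_gt (i + 1 + k + 1) (by omega) (by omega)]
  rw [e1, e2, h_le i le_rfl, h_gt (i + 1) (by omega) (by omega)]
  omega

/-- The cyclic permutation moving position `j` to the end. -/
def moveToEnd (j : Fin (n + 1)) : Perm (Fin (n + 1)) :=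
  (finSuccEquiv' j).trans finSuccEquivLast.symm

@[simp] lemma moveToEnd_self (j : Fin (n + 1)) : moveToEnd j j = Fin.last n := by
  simp [moveToEnd]

@[simp] lemma moveToEnd_succAbove (j : Fin (n + 1)) (k : Fin n) :
    moveToEnd j (j.succAbove k) = k.castSucc := by
  simp [moveToEnd]

lemma moveToEnd_last : moveToEnd (Fin.last n) = 1 := by
  ext i
  simp [moveToEnd, finSuccEquivLast]

lemma desB_eq_sum (p : SignedPerm n) :
    desB p = ∑ k ∈ range n, if appB p (k : ℤ) > appB p (k + 1 : ℕ) then 1 else 0 := by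
  unfold desB
  rw [card_filter, ← Fin.sum_univ_eq_sum_range
    (fun k => if appB p (k : ℤ) > appB p (k + 1 : ℕ) then 1 else 0)]
  simp

lemma appB_insert_of_le (p : SignedPerm n) (d : Bool) (j : Fin (n + 1)) (k : ℕ) (hk : k ≤ j) :
    appB (precomp (extendLast p d) (moveToEnd j)) (k : ℤ) = appB p (k : ℤ) := by
  rcases k with _ | k
  · simp [appB_zero]
  · have hj := j.2
    have e1 := appB_succ p ⟨k, by omega⟩
    have e2 := appB_succ (precomp (extendLast p d) (moveToEnd j)) ⟨k, by omega⟩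
    have hs : (⟨k, by omega⟩ : Fin (n + 1)) = j.succAbove ⟨k, by omega⟩ := by
      rw [Fin.succAbove_of_castSucc_lt]
      · rfl
      · exact Fin.lt_def.2 hk
    rw [hs, valB_precomp, moveToEnd_succAbove, valB_extendLast_castSucc, ← hs] at e2
    push_cast
    exact e2.trans e1.symm

lemma appB_insert_self (p : SignedPerm n) (d : Bool) (j : Fin (n + 1)) :
    appB (precomp (extendLast p d) (moveToEnd j)) ((j : ℕ) + 1 : ℕ) = topVal n d := by
  have := appB_succ (precomp (extendLast p d) (moveToEnd j)) j
  push_cast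
  rw [this, valB_precomp, moveToEnd_self, valB_extendLast_last]

lemma appB_insert_of_gt (p : SignedPerm n) (d : Bool) (j : Fin (n + 1)) (k : ℕ) (hk : j < k)
    (hkn : k ≤ n) :
    appB (precomp (extendLast p d) (moveToEnd j)) ((k + 1 : ℕ) : ℤ) = appB p (k : ℤ) := by
  obtain ⟨k, rfl⟩ : ∃ l, k = l + 1 := ⟨k - 1, by omega⟩
  have e1 := appB_succ p ⟨k, by omega⟩
  have e2 := appB_succ (precomp (extendLast p d) (moveToEnd j)) ⟨k + 1, by omega⟩
  have hs : (⟨k + 1, by omega⟩ : Fin (n + 1)) = j.succAbove ⟨k, by omega⟩ := by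
    rw [Fin.succAbove_of_le_castSucc]
    · rfl
    · exact Fin.le_def.2 (Nat.lt_succ_iff.1 hk)
  rw [hs, valB_precomp, moveToEnd_succAbove, valB_extendLast_castSucc, ← hs] at e2
  exact_mod_cast e2.trans e1.symm

lemma desB_extendLast (p : SignedPerm n) (d : Bool) :
    desB (extendLast p d) = desB p + if d then 1 else 0 := by
  have hp : extendLast p d = precomp (extendLast p d) (moveToEnd (Fin.last n)) := by
    rw [moveToEnd_last]; rfl
  rw [hp, desB_eq_sum, desB_eq_sum, sum_range_succ]
  congr 1
  · refine sum_congr rfl fun k hk => ?_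
    have := mem_range.1 hk
    rw [appB_insert_of_le _ _ _ _ (by simp; omega), appB_insert_of_le _ _ _ _ (by simp; omega)]
  · have h1 := appB_insert_self p d (Fin.last n)
    rw [Fin.val_last] at h1
    rw [h1, appB_insert_of_le _ _ _ _ (by simp)]
    have := appB_bounds p n
    unfold topVal
    cases d <;> simp <;> omega

lemma desB_insert (p : SignedPerm n) (d : Bool) (i : Fin n) :
    desB (precomp (extendLast p d) (moveToEnd i.castSucc)) =
      desB p + if appB p (i : ℤ) > appB p ((i : ℤ) + 1) then 0 else 1 := by
  have h1 := appB_insert_self p d i.castSucc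
  have key := sum_insert_descents (fun k : ℕ => appB p (k : ℤ))
    (fun k : ℕ => appB (precomp (extendLast p d) (moveToEnd i.castSucc)) (k : ℤ)) i.2
    (fun k hk => appB_insert_of_le p d i.castSucc k hk)
    (fun k hk hkn => appB_insert_of_gt p d i.castSucc k hk hkn) (by
      rw [Fin.val_castSucc] at h1
      simp only [h1]
      have b1 := appB_bounds p (i : ℕ)
      have b2 := appB_bounds p ((i : ℕ) + 1 : ℕ)
      push_cast at b2 ⊢
      unfold topVal
      cases d
      · rw [if_neg (by simp; omega), if_pos (by simp; omega)]
      · rw [if_pos (by simp; omega), if_neg (by simp; omega)])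
  rw [desB_eq_sum, desB_eq_sum]
  push_cast at key ⊢
  split_ifs at key ⊢ <;> omega

end Descents

section Excedances

variable {n : ℕ}

/-- The value of absolute value `j + 1` taken by the signed permutation on `[n]`. -/
def inVal (p : SignedPerm n) (j : Fin n) : ℤ := valB p (p.1⁻¹ j)

/-- The condition for `j` to contribute to the type B excedance number. -/
def IsExcB (p : SignedPerm n) (j : Fin n) : Prop :=
  valB p j > inVal p j ∨ valB p j = -((j : ℤ) + 1)

instance (p : SignedPerm n) : DecidablePred (IsExcB p) := fun _ => by
  unfold IsExcB; infer_instance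

lemma inVal_eq (p : SignedPerm n) (j : Fin n) :
    inVal p j = if p.2 (p.1⁻¹ j) then -((j : ℤ) + 1) else (j : ℤ) + 1 := by
  simp [inVal, valB]

lemma inVal_of_valB_eq (p : SignedPerm n) (j : Fin n) (h : valB p j = -((j : ℤ) + 1)) :
    inVal p j = valB p j := by
  have h1 := valB_abs p j
  rw [h, abs_neg, abs_of_pos (by positivity)] at h1
  have h2 : p.1 j = j := Fin.ext (by omega)
  rw [inVal, show p.1⁻¹ j = j from Perm.inv_eq_iff_eq.2 h2.symm]

lemma excB_eq_card (p : SignedPerm n) : excB p = (univ.filter (IsExcB p)).card := by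
  unfold excB IsExcB
  rw [filter_or, card_union_of_disjoint]
  · congr 1
    refine card_bij (fun i _ => p.1 i) ?_ ?_ ?_
    · intro i hi
      simpa [valB_abs, appB_succ, inVal] using hi
    · intro i _ j _ h
      exact p.1.injective h
    · intro j hj
      refine ⟨p.1⁻¹ j, ?_, by simp⟩
      simpa [valB_abs, appB_succ, inVal] using hj
  · rw [disjoint_filter]
    intro j _ h h'
    exact absurd (inVal_of_valB_eq p j h') (by omega)

lemma inVal_precomp (p : SignedPerm n) (c : Perm (Fin n)) (j : Fin n) :
    inVal (precomp p c) j = inVal p j := by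
  simp [inVal, precomp, valB]

@[simp] lemma inVal_extendLast_castSucc (p : SignedPerm n) (d : Bool) (j : Fin n) :
    inVal (extendLast p d) j.castSucc = inVal p j := by
  have : (extendLast p d).1⁻¹ j.castSucc = (p.1⁻¹ j).castSucc := by
    rw [Perm.inv_eq_iff_eq]
    simp
  simp [inVal, this]

@[simp] lemma inVal_extendLast_last (p : SignedPerm n) (d : Bool) :
    inVal (extendLast p d) (Fin.last n) = topVal n d := by
  have : (extendLast p d).1⁻¹ (Fin.last n) = Fin.last n := by
    rw [Perm.inv_eq_iff_eq]
    simp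
  simp [inVal, this]

lemma excB_extendLast (p : SignedPerm n) (d : Bool) :
    excB (extendLast p d) = excB p + if d then 1 else 0 := by
  rw [excB_eq_card, excB_eq_card, card_filter, card_filter, Fin.sum_univ_castSucc]
  congr 1
  · simp [IsExcB]
  · cases d <;> simp [IsExcB, topVal]
    omega

lemma excB_insert (p : SignedPerm n) (d : Bool) (i : Fin n) :
    excB (precomp (extendLast p d) (swap i.castSucc (Fin.last n))) =
      excB p + if IsExcB p i then 0 else 1 := by
  have e1 : ∀ j ∈ univ.erase i,
      (if IsExcB (precomp (extendLast p d) (swap i.castSucc (Fin.last n))) j.castSucc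
        then 1 else 0) = if IsExcB p j then 1 else 0 := by
    intro j hj
    have hji : j ≠ i := ne_of_mem_erase hj
    have hs : swap i.castSucc (Fin.last n) j.castSucc = j.castSucc :=
      swap_apply_of_ne_of_ne (by simpa using hji) (Fin.castSucc_lt_last j).ne
    simp [IsExcB, inVal_precomp, hs]
  have e2 : (if IsExcB (precomp (extendLast p d) (swap i.castSucc (Fin.last n))) i.castSucc
        then 1 else 0) + (if IsExcB (precomp (extendLast p d) (swap i.castSucc (Fin.last n)))
          (Fin.last n) then 1 else 0) = 1 := by
    have hi := i.2
    have b1 := valB_bounds p i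
    have b2 : -(n : ℤ) ≤ inVal p i ∧ inVal p i ≤ n := valB_bounds p _
    simp only [IsExcB, inVal_precomp, valB_precomp, swap_apply_left, swap_apply_right,
      valB_extendLast_castSucc, valB_extendLast_last, inVal_extendLast_castSucc,
      inVal_extendLast_last, Fin.val_castSucc, Fin.val_last, topVal]
    cases d
    · rw [if_pos (by simp; omega), if_neg (by simp; omega)]
    · rw [if_neg (by simp; omega), if_pos (by simp; omega)]
  rw [excB_eq_card, excB_eq_card, card_filter, card_filter, Fin.sum_univ_castSucc,
    ← add_sum_erase univ _ (mem_univ i), sum_congr rfl e1,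
    ← add_sum_erase univ (fun j => if IsExcB p j then 1 else 0) (mem_univ i)]
  split_ifs at e2 ⊢ <;> omega

end Excedances

/-- Type B excedances and type B descents have the same joint distribution with the
determinant. -/
lemma sum_excB_detB_eq_sum_desB_detB {M : Type*} [AddCommMonoid M] (n : ℕ) (g : ℕ → ℤˣ → M) :
    ∑ p : SignedPerm n, g (excB p) (detB p) = ∑ p : SignedPerm n, g (desB p) (detB p) := by
  induction n generalizing g with
  | zero => exact sum_congr rfl fun p _ => by simp [excB, desB]
  | succ n ih =>
    rw [sum_insertion excB excB IsExcB excB_eq_card (fun j => swap j (Fin.last n))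
        (fun j => swap_apply_left _ _) (swap_self _) excB_extendLast excB_insert,
      sum_insertion desB desB (fun p i => appB p (i : ℤ) > appB p ((i : ℤ) + 1)) (fun _ => rfl)
        moveToEnd moveToEnd_self moveToEnd_last desB_extendLast desB_insert]
    exact ih fun k s => k • (g k 1 + g k (-1)) + (n - k) • (g (k + 1) 1 + g (k + 1) (-1)) +
      (g k s + g (k + 1) (-s))

/-- For every positive integer `n` and every `0 ≤ k ≤ n`, `P^B_{n,k} = B⁺_{n,k}` and
`Q^B_{n,k} = B⁻_{n,k}`: on each of `B_n⁺` and `B_n⁻`, the number of elements with `k`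
type B excedances equals the number of elements with `k` type B descents. -/
theorem typeB_excedance_eq_descent (n : ℕ) (hn : 1 ≤ n) (k : ℕ) (hk : k ≤ n) :
    PB n k = Bp n k ∧ QB n k = Bm n k := by
  constructor
  · simp only [PB, Bp, even_invB_iff, card_filter]
    exact sum_excB_detB_eq_sum_desB_detB n fun e s => if s = 1 ∧ e = k then 1 else 0
  · simp only [QB, Bm, even_invB_iff, card_filter]
    exact sum_excB_detB_eq_sum_desB_detB n fun e s => if ¬ s = 1 ∧ e = k then 1 else 0
end
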